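/- arXiv:1003.4015 — 2 statements merged into one kernel-verified Lean document; each statement's English description precedes it below -/
import Mathlib

section
/- Let F_n denote the n-th Fibonacci number (F_1 = F_2 = 1) and φ = (1 + √5)/2 the golden ratio. Then there exists a positive constant C such that the product of the first n Fibonacci numbers satisfies ∏_{k=1}^{n} F_k = φ^{n(n+1)/2} · 5^{−n/2} · C + O(φ^{n(n−3)/2} · 5^{−n/2}); in particular, the quantity (∏_{k=1}^{n} F_k) · 5^{n/2} / φ^{n(n+1)/2} converges to a positive limit C as n → ∞. -/
open Filter Topology Asymptotics

lemma fibq_aux (a b : ℝ) (m : ℕ) (ha : a ≠ 0) :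
    a ^ m - b ^ m = a ^ m * (1 + -(b / a) ^ m) := by
  rw [div_pow]
  field_simp
  ring

lemma fibq_aux2 (x y p a t s : ℝ) :
    x * y * p * (a * t / s) = x * a * (y * s⁻¹) * (p * t) := by
  ring

lemma fibq_prod (n : ℕ) : (∏ k ∈ Finset.Icc 1 n, (Nat.fib k : ℝ)) =
    Real.goldenRatio ^ ((n : ℝ) * ((n : ℝ) + 1) / 2) * (5 : ℝ) ^ (-(n : ℝ) / 2) *
      ∏ i ∈ Finset.range n, (1 + -(Real.goldenConj / Real.goldenRatio) ^ (i + 1)) := by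
  have hp := Real.goldenRatio_pos
  induction n with
  | zero => simp
  | succ n ih =>
    rw [Finset.prod_Icc_succ_top (by omega), ih, Finset.prod_range_succ, Real.coe_fib_eq]
    have e1 : Real.goldenRatio ^ (((n + 1 : ℕ) : ℝ) * (((n + 1 : ℕ) : ℝ) + 1) / 2) =
        Real.goldenRatio ^ ((n : ℝ) * ((n : ℝ) + 1) / 2) * Real.goldenRatio ^ (n + 1) := by
      rw [← Real.rpow_natCast, ← Real.rpow_add hp]
      congr 1
      push_cast
      ring
    have e2 : (5 : ℝ) ^ (-((n + 1 : ℕ) : ℝ) / 2) = (5 : ℝ) ^ (-(n : ℝ) / 2) * (√5)⁻¹ := by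
      rw [Real.sqrt_eq_rpow, ← Real.rpow_neg (by norm_num), ← Real.rpow_add (by norm_num)]
      congr 1
      push_cast
      ring
    have e3 : Real.goldenRatio ^ (n + 1) - Real.goldenConj ^ (n + 1) =
        Real.goldenRatio ^ (n + 1) *
          (1 + -(Real.goldenConj / Real.goldenRatio) ^ (n + 1)) := by
      exact fibq_aux _ _ _ hp.ne'
    rw [e1, e2, e3]
    exact fibq_aux2 _ _ _ _ _ _

lemma fibq_abs : |Real.goldenConj / Real.goldenRatio| = Real.goldenRatio ^ (-2 : ℝ) := by
  have hp := Real.goldenRatio_pos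
  have h : -Real.goldenConj = Real.goldenRatio⁻¹ := Real.inv_goldenRatio.symm
  rw [abs_div, abs_of_neg Real.goldenConj_neg, abs_of_pos hp, h, Real.rpow_neg hp.le]
  norm_cast
  field_simp

lemma fibq_limit (q : ℝ) (hq : |q| < 1) : ∃ C K : ℝ, 0 < C ∧
    Tendsto (fun n : ℕ => ∏ i ∈ Finset.range n, (1 + -q ^ (i + 1))) atTop (𝓝 C) ∧
    ∀ n : ℕ, |(∏ i ∈ Finset.range n, (1 + -q ^ (i + 1))) - C| ≤ K * |q| ^ n := by
  have hs : Summable (fun i : ℕ => -q ^ (i + 1)) := by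
    have := (summable_geometric_of_abs_lt_one hq)
    exact ((summable_nat_add_iff 1).2 this).neg
  have hpos : ∀ i : ℕ, 0 < 1 + -q ^ (i + 1) := by
    intro i
    have h1 : |q ^ (i + 1)| < 1 := by
      rw [abs_pow]
      exact pow_lt_one₀ (abs_nonneg q) hq (by omega)
    have := (abs_lt.1 h1).2
    linarith
  have hl := (Real.summable_log_one_add_of_summable hs).hasSum.tendsto_sum_nat
  have ht := (Real.continuous_exp.tendsto _).comp hl
  set S := ∑' i : ℕ, Real.log (1 + -q ^ (i + 1))
  have ht' : Tendsto (fun n : ℕ => ∏ i ∈ Finset.range n, (1 + -q ^ (i + 1))) atTop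
      (𝓝 (Real.exp S)) := by
    refine ht.congr fun n => ?_
    simp only [Function.comp, Real.exp_sum]
    exact Finset.prod_congr rfl fun i _ => Real.exp_log (hpos i)
  obtain ⟨B, hB⟩ := ht'.bddAbove_range
  have hB' : ∀ n : ℕ, ∏ i ∈ Finset.range n, (1 + -q ^ (i + 1)) ≤ B := fun n => hB ⟨n, rfl⟩
  refine ⟨Real.exp S, B * |q| / (1 - |q|), Real.exp_pos S, ht', fun n => ?_⟩
  have hd : ∀ n : ℕ, dist (∏ i ∈ Finset.range n, (1 + -q ^ (i + 1)))
      (∏ i ∈ Finset.range (n + 1), (1 + -q ^ (i + 1))) ≤ B * |q| * |q| ^ n := by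
    intro n
    have h0 : 0 ≤ ∏ i ∈ Finset.range n, (1 + -q ^ (i + 1)) :=
      Finset.prod_nonneg fun i _ => (hpos i).le
    rw [Finset.prod_range_succ, Real.dist_eq]
    generalize hP : ∏ i ∈ Finset.range n, (1 + -q ^ (i + 1)) = P at h0
    have hPB : P ≤ B := hP ▸ hB' n
    have e : P - P * (1 + -q ^ (n + 1)) = P * q ^ (n + 1) := by ring
    rw [e, abs_mul, abs_of_nonneg h0, abs_pow, pow_succ, mul_assoc, mul_comm (|q| ^ n)]
    gcongr
  have := dist_le_of_le_geometric_of_tendsto |q| (B * |q|) hq hd ht' n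
  rw [Real.dist_eq] at this
  refine this.trans_eq ?_
  ring

/-- With `Fₙ` the Fibonacci numbers (`F₁ = F₂ = 1`) and `φ = (1 + √5)/2`, there is a
constant `C > 0` with `∏_{k=1}^{n} Fₖ = φ^(n(n+1)/2) · 5^(−n/2) · C +
O(φ^(n(n−3)/2) · 5^(−n/2))`; in particular `(∏_{k=1}^{n} Fₖ) · 5^(n/2) / φ^(n(n+1)/2)`
converges to `C`. -/
theorem fibonacci_product_asymptotics :
    ∃ C : ℝ, 0 < C ∧
      Tendsto
        (fun n : ℕ =>
          (∏ k ∈ Finset.Icc 1 n, (Nat.fib k : ℝ)) * (5 : ℝ) ^ ((n : ℝ) / 2) /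
            ((1 + Real.sqrt 5) / 2) ^ ((n : ℝ) * ((n : ℝ) + 1) / 2))
        atTop (𝓝 C) ∧
      (fun n : ℕ =>
          (∏ k ∈ Finset.Icc 1 n, (Nat.fib k : ℝ)) -
            ((1 + Real.sqrt 5) / 2) ^ ((n : ℝ) * ((n : ℝ) + 1) / 2) *
              (5 : ℝ) ^ (-(n : ℝ) / 2) * C) =O[atTop]
        (fun n : ℕ =>
          ((1 + Real.sqrt 5) / 2) ^ ((n : ℝ) * ((n : ℝ) - 3) / 2) *
            (5 : ℝ) ^ (-(n : ℝ) / 2)) := by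
  have hp := Real.goldenRatio_pos
  have hq : |Real.goldenConj / Real.goldenRatio| < 1 := by
    rw [fibq_abs]
    exact Real.rpow_lt_one_of_one_lt_of_neg Real.one_lt_goldenRatio (by norm_num)
  obtain ⟨C, K, hC, ht, hK⟩ := fibq_limit _ hq
  change ∃ C : ℝ, 0 < C ∧
      Tendsto
        (fun n : ℕ =>
          (∏ k ∈ Finset.Icc 1 n, (Nat.fib k : ℝ)) * (5 : ℝ) ^ ((n : ℝ) / 2) /
            Real.goldenRatio ^ ((n : ℝ) * ((n : ℝ) + 1) / 2))
        atTop (𝓝 C) ∧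
      (fun n : ℕ =>
          (∏ k ∈ Finset.Icc 1 n, (Nat.fib k : ℝ)) -
            Real.goldenRatio ^ ((n : ℝ) * ((n : ℝ) + 1) / 2) *
              (5 : ℝ) ^ (-(n : ℝ) / 2) * C) =O[atTop]
        (fun n : ℕ =>
          Real.goldenRatio ^ ((n : ℝ) * ((n : ℝ) - 3) / 2) *
            (5 : ℝ) ^ (-(n : ℝ) / 2))
  refine ⟨C, hC, ht.congr fun n => ?_, ?_⟩
  · rw [fibq_prod, neg_div, Real.rpow_neg (by norm_num)]
    have h1 : (0 : ℝ) < (5 : ℝ) ^ ((n : ℝ) / 2) := by positivity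
    have h2 : 0 < Real.goldenRatio ^ ((n : ℝ) * ((n : ℝ) + 1) / 2) := Real.rpow_pos_of_pos hp _
    field_simp
  · refine IsBigO.of_bound K (Eventually.of_forall fun n => ?_)
    have h1 : (0 : ℝ) < (5 : ℝ) ^ (-(n : ℝ) / 2) := by positivity
    have h2 : 0 < Real.goldenRatio ^ ((n : ℝ) * ((n : ℝ) + 1) / 2) := Real.rpow_pos_of_pos hp _
    have h3 : Real.goldenRatio ^ ((n : ℝ) * ((n : ℝ) - 3) / 2) =
        Real.goldenRatio ^ ((n : ℝ) * ((n : ℝ) + 1) / 2) *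
          |Real.goldenConj / Real.goldenRatio| ^ n := by
      rw [fibq_abs, ← Real.rpow_natCast, ← Real.rpow_mul hp.le, ← Real.rpow_add hp]
      congr 1
      ring
    have h4 : 0 ≤ Real.goldenRatio ^ ((n : ℝ) * ((n : ℝ) + 1) / 2) *
        |Real.goldenConj / Real.goldenRatio| ^ n * (5 : ℝ) ^ (-(n : ℝ) / 2) :=
      mul_nonneg (mul_nonneg h2.le (pow_nonneg (abs_nonneg _) _)) h1.le
    rw [fibq_prod, ← mul_sub, h3, Real.norm_eq_abs, Real.norm_eq_abs, abs_mul,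
      abs_of_pos (mul_pos h2 h1), abs_of_nonneg h4]
    refine (mul_le_mul_of_nonneg_left (hK n) (mul_pos h2 h1).le).trans_eq ?_
    ring
end

section
/- The superfactorial n!^! = ∏_{k=1}^{n} k! satisfies the asymptotic formula n!^! ~ e^{n²(log(n)/2 − 3/4)}; precisely, (log(∏_{k=1}^{n} k!) − (n²/2)·log n)/n² converges to −3/4 as n → ∞. -/
open Filter Topology

/-- Elementary bounds for `log (n+1) - log n`. -/
lemma log_step (n : ℕ) (hn : 1 ≤ n) :
    (n : ℝ) * (Real.log ((n : ℝ) + 1) - Real.log n) ≤ 1 ∧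
      1 ≤ ((n : ℝ) + 1) * (Real.log ((n : ℝ) + 1) - Real.log n) := by
  have h0 : (0 : ℝ) < n := by exact_mod_cast hn
  have h1 : (0 : ℝ) < (n : ℝ) + 1 := by positivity
  have e : Real.log ((n : ℝ) + 1) - Real.log n = Real.log (((n : ℝ) + 1) / n) :=
    (Real.log_div h1.ne' h0.ne').symm
  rw [e]
  have a := Real.log_le_sub_one_of_pos (show 0 < ((n : ℝ) + 1) / n by positivity)
  have b := Real.one_sub_inv_le_log_of_pos (show 0 < ((n : ℝ) + 1) / n by positivity)
  constructor
  · calc _ ≤ (n : ℝ) * (((n : ℝ) + 1) / n - 1) := by gcongr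
      _ = 1 := by field_simp; ring
  · calc (1 : ℝ) = ((n : ℝ) + 1) * (1 - (((n : ℝ) + 1) / n)⁻¹) := by field_simp; ring
      _ ≤ _ := by gcongr

lemma log_fact_bounds (n : ℕ) (hn : 1 ≤ n) :
    (n : ℝ) * Real.log n - n ≤ Real.log (Nat.factorial n : ℝ) ∧
      Real.log (Nat.factorial n : ℝ) ≤ ((n : ℝ) + 1) * Real.log n - n + 1 := by
  induction n, hn using Nat.le_induction with
  | base => norm_num
  | succ n hn ih =>
    obtain ⟨a, b⟩ := log_step n hn
    have hf : (Nat.factorial n : ℝ) ≠ 0 := by positivity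
    have e : Real.log (Nat.factorial (n + 1) : ℝ)
        = Real.log ((n : ℝ) + 1) + Real.log (Nat.factorial n : ℝ) := by
      rw [Nat.factorial_succ, Nat.cast_mul, Real.log_mul (by positivity) hf]
      push_cast; rfl
    rw [e]
    push_cast
    constructor <;> nlinarith [ih.1, ih.2]

lemma log_superfact_bounds (n : ℕ) (hn : 1 ≤ n) :
    (n : ℝ) ^ 2 / 2 * Real.log n - 3 / 4 * (n : ℝ) ^ 2 - n
        ≤ Real.log (∏ k ∈ Finset.Icc 1 n, (Nat.factorial k : ℝ)) ∧
      Real.log (∏ k ∈ Finset.Icc 1 n, (Nat.factorial k : ℝ)) ≤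
        (n : ℝ) ^ 2 / 2 * Real.log n - 3 / 4 * (n : ℝ) ^ 2
          + (3 / 2 * n * Real.log n + 5 / 4 * n) := by
  induction n, hn using Nat.le_induction with
  | base => norm_num
  | succ n hn ih =>
    obtain ⟨a, b⟩ := log_step n hn
    obtain ⟨c, d⟩ := log_fact_bounds (n + 1) (by omega)
    have h0 : (1 : ℝ) ≤ n := by exact_mod_cast hn
    have hl : 0 ≤ Real.log n := Real.log_nonneg h0
    have hl' : 0 ≤ Real.log ((n : ℝ) + 1) := Real.log_nonneg (by linarith)
    have hp : (∏ k ∈ Finset.Icc 1 n, (Nat.factorial k : ℝ)) ≠ 0 :=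
      Finset.prod_ne_zero_iff.2 fun k _ => by positivity
    rw [Finset.prod_Icc_succ_top (by omega), Real.log_mul hp (by positivity)]
    push_cast at c d ⊢
    set x := Real.log (n : ℝ)
    set y := Real.log ((n : ℝ) + 1)
    set m := (n : ℝ)
    have hd : 0 ≤ y - x := by
      by_contra h
      push Not at h
      nlinarith
    have h1 : m ^ 2 * (y - x) ≤ m := by nlinarith
    have h2 : m - 1 ≤ m ^ 2 * (y - x) := by nlinarith
    have h3 : 0 ≤ m * (y - x) := by positivity
    constructor
    · nlinarith [ih.1]
    · nlinarith [ih.2]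

/-- The superfactorial `n!^! = ∏_{k=1}^{n} k!` satisfies
`n!^! ~ e^(n²(log n / 2 − 3/4))`: the quantity
`(log (∏_{k=1}^{n} k!) − (n²/2)·log n)/n²` converges to `−3/4`. -/
theorem superfactorial_asymptotics :
    Tendsto
      (fun n : ℕ =>
        (Real.log (∏ k ∈ Finset.Icc 1 n, (Nat.factorial k : ℝ)) -
            (n : ℝ) ^ 2 / 2 * Real.log n) / (n : ℝ) ^ 2)
      atTop (𝓝 (-3 / 4)) := by
  have hinv : Tendsto (fun n : ℕ => ((n : ℝ))⁻¹) atTop (𝓝 0) :=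
    tendsto_inv_atTop_zero.comp tendsto_natCast_atTop_atTop
  have hlog : Tendsto (fun n : ℕ => Real.log (n : ℝ) / n) atTop (𝓝 0) :=
    (Real.isLittleO_log_id_atTop.tendsto_div_nhds_zero).comp tendsto_natCast_atTop_atTop
  have hlo : Tendsto (fun n : ℕ => (-3 / 4 : ℝ) - ((n : ℝ))⁻¹) atTop (𝓝 (-3 / 4)) := by
    simpa using hinv.const_sub (-3 / 4 : ℝ)
  have hhi : Tendsto (fun n : ℕ => (-3 / 4 : ℝ) + (3 / 2 * (Real.log (n : ℝ) / n)
      + 5 / 4 * ((n : ℝ))⁻¹)) atTop (𝓝 (-3 / 4)) := by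
    simpa using ((hlog.const_mul (3 / 2 : ℝ)).add (hinv.const_mul (5 / 4 : ℝ))).const_add
      (-3 / 4 : ℝ)
  refine tendsto_of_tendsto_of_tendsto_of_le_of_le' hlo hhi ?_ ?_
  · filter_upwards [eventually_ge_atTop 1] with n hn
    have h0 : (0 : ℝ) < n := by exact_mod_cast hn
    rw [le_div_iff₀ (by positivity)]
    have e : ((-3 / 4 : ℝ) - ((n : ℝ))⁻¹) * (n : ℝ) ^ 2 = -3 / 4 * (n : ℝ) ^ 2 - n := by
      field_simp
    rw [e]
    linarith [(log_superfact_bounds n hn).1]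
  · filter_upwards [eventually_ge_atTop 1] with n hn
    have h0 : (0 : ℝ) < n := by exact_mod_cast hn
    rw [div_le_iff₀ (by positivity)]
    have e : ((-3 / 4 : ℝ) + (3 / 2 * (Real.log (n : ℝ) / n)
      + 5 / 4 * ((n : ℝ))⁻¹)) * (n : ℝ) ^ 2 =
      -3 / 4 * (n : ℝ) ^ 2 + (3 / 2 * n * Real.log n + 5 / 4 * n) := by
      field_simp
    rw [e]
    linarith [(log_superfact_bounds n hn).2]
end
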